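/- Let n : ℕ and let ψ φ : EuclideanSpace ℂ (Fin n) be unit vectors. Suppose there exists a matrix τ : Matrix (Fin n) (Fin n) ℂ with τ.PosSemidef and τ ≠ 0 such that for every x : Fin n → ℂ, the vector τ.mulVec x is a scalar multiple of ψ (viewed as a function Fin n → ℂ) and is also a scalar multiple of φ. Then outer ψ = outer φ, where outer v denotes the matrix (fun i j => v i * conj (v j)). (This is the paper's statement, following Leifer and Spekkens, that density operators corresponding to pure states are compatible—i.e. admit a common refinement supported in both of their ranges—if and only if they are equal.) -/

import Mathlib

noncomputable section

open scoped BigOperators ComplexOrder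

/-- Standard basis vector at index `p`. -/
def e {I : Type*} [DecidableEq I] (p : I) : EuclideanSpace ℂ I :=
  EuclideanSpace.single p 1

/-- Outer product `|v⟩⟨v|` as a matrix. -/
def outer {I : Type*} (v : EuclideanSpace ℂ I) : Matrix I I ℂ :=
  fun i j => v i * (starRingEnd ℂ) (v j)

theorem stmt16 {n : ℕ} (ψ φ : EuclideanSpace ℂ (Fin n))
    (hψ : ‖ψ‖ = 1) (hφ : ‖φ‖ = 1)
    (hτ : ∃ τ : Matrix (Fin n) (Fin n) ℂ, τ.PosSemidef ∧ τ ≠ 0 ∧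
      ∀ x : Fin n → ℂ,
        (∃ c : ℂ, τ.mulVec x = c • (ψ : Fin n → ℂ)) ∧
        (∃ c : ℂ, τ.mulVec x = c • (φ : Fin n → ℂ))) :
    outer ψ = outer φ := by
  obtain ⟨τ, -, hne, h⟩ := hτ
  have hx : ∃ x : Fin n → ℂ, τ.mulVec x ≠ 0 := by
    by_contra! hc
    apply hne
    ext i j
    have := congrFun (hc (Pi.single j 1)) i
    simpa using this
  obtain ⟨x, hx⟩ := hx
  obtain ⟨⟨c, hc⟩, ⟨d, hd⟩⟩ := h x
  have hc0 : c ≠ 0 := by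
    rintro rfl
    exact hx (by rw [hc, zero_smul])
  have hk : ψ = (c⁻¹ * d) • φ := by
    ext i
    have h1 : c * ψ i = d * φ i := by
      have := congrFun (hc.symm.trans hd) i
      simpa using this
    have h2 : ψ i = c⁻¹ * d * φ i := by
      rw [mul_assoc, ← h1, inv_mul_cancel_left₀ hc0]
    simpa using h2
  generalize c⁻¹ * d = k at hk
  have hn : ‖k‖ = 1 := by
    rw [hk, norm_smul, hφ, mul_one] at hψ
    exact hψ
  have hkk : k * (starRingEnd ℂ) k = 1 := by
    rw [Complex.mul_conj']
    simp [hn]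
  ext i j
  simp only [outer, hk, PiLp.smul_apply, smul_eq_mul, map_mul]
  linear_combination (φ i * (starRingEnd ℂ) (φ j)) * hkk
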